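/- Fix an integer k and let φ_k(z,w) = (1+|z|²+|w|²)^{-(k+3)} and Y = {(z,w) ∈ ℂ² : |w| > √2, |z| < 1/|w|}. Then for nonnegative integers p, q, the monomial z^p w^q satisfies ∫_Y |z|^{2p} |w|^{2q} φ_k(z,w) dλ(z,w) < ∞ if and only if q − p ≤ k + 2. -/

import Mathlib

open MeasureTheory Complex

/-- comparison of powers -/
lemma aux_zpow (a b : ℝ) (ha : 0 < a) (h1 : a ≤ b) (h2 : b ≤ 2 * a) (m : ℤ) :
    b ^ m ≤ 2 ^ m.natAbs * a ^ m ∧ a ^ m ≤ 2 ^ m.natAbs * b ^ m := by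
  have hb : 0 < b := ha.trans_le h1
  obtain ⟨n, rfl | rfl⟩ := m.eq_nat_or_neg
  · simp only [zpow_natCast, Int.natAbs_natCast, ← mul_pow]
    constructor <;> gcongr
    linarith
  · simp only [zpow_neg, zpow_natCast, Int.natAbs_neg, Int.natAbs_natCast]
    have e : ∀ x : ℝ, (2:ℝ) ^ n * (x ^ n)⁻¹ = ((x / 2) ^ n)⁻¹ := by
      intro x; rw [div_pow, inv_div]; rfl
    rw [e, e]
    constructor <;> gcongr <;> linarith

/-- the region -/
def YY : Set (ℂ × ℂ) := {zw : ℂ × ℂ | Real.sqrt 2 < ‖zw.2‖ ∧ ‖zw.1‖ < 1 / ‖zw.2‖}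

lemma YY_meas : MeasurableSet YY := by
  have h1 : MeasurableSet {x : ℂ × ℂ | Real.sqrt 2 < ‖x.2‖} :=
    measurableSet_lt (by fun_prop) (by fun_prop)
  have h2 : MeasurableSet {x : ℂ × ℂ | ‖x.1‖ < 1 / ‖x.2‖} :=
    measurableSet_lt (by fun_prop) (by fun_prop)
  exact h1.inter h2

lemma YY_bd {x : ℂ × ℂ} (hx : x ∈ YY) (m : ℤ) :
    let a := ‖x.2‖ ^ 2
    let b := 1 + ‖x.1‖ ^ 2 + ‖x.2‖ ^ 2
    b ^ m ≤ 2 ^ m.natAbs * a ^ m ∧ a ^ m ≤ 2 ^ m.natAbs * b ^ m := by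
  obtain ⟨h1, h2⟩ := hx
  have h0 : 0 < ‖x.2‖ := (Real.sqrt_nonneg 2).trans_lt h1
  have h3 : 2 < ‖x.2‖ ^ 2 := (Real.sqrt_lt' h0).1 h1
  have h4 : ‖x.1‖ ≤ 1 := by
    refine h2.le.trans ?_
    rw [div_le_one h0]; nlinarith
  have h5 : ‖x.1‖ ^ 2 ≤ 1 := pow_le_one₀ (norm_nonneg _) h4
  apply aux_zpow
  · positivity
  · nlinarith [sq_nonneg ‖x.1‖]
  · linarith

lemma step1 (p q : ℕ) (m : ℤ) :
    IntegrableOn (fun zw : ℂ × ℂ => ‖zw.1‖ ^ (2 * p) * ‖zw.2‖ ^ (2 * q) *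
          (1 + ‖zw.1‖ ^ 2 + ‖zw.2‖ ^ 2) ^ m) YY volume ↔
    IntegrableOn (fun zw : ℂ × ℂ => ‖zw.1‖ ^ (2 * p) * ‖zw.2‖ ^ (2 * q) *
          (‖zw.2‖ ^ 2) ^ m) YY volume := by
  constructor
  · intro h
    refine Integrable.mono' (h.const_mul (2 ^ m.natAbs)) (Measurable.aestronglyMeasurable (by measurability)) ?_
    filter_upwards [ae_restrict_mem YY_meas] with x hx
    rw [Real.norm_of_nonneg (by positivity), mul_left_comm]
    exact mul_le_mul_of_nonneg_left (YY_bd hx m).2 (by positivity)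
  · intro h
    refine Integrable.mono' (h.const_mul (2 ^ m.natAbs)) (Measurable.aestronglyMeasurable (by measurability)) ?_
    filter_upwards [ae_restrict_mem YY_meas] with x hx
    rw [Real.norm_of_nonneg (by positivity), mul_left_comm]
    exact mul_le_mul_of_nonneg_left (YY_bd hx m).1 (by positivity)

/-- radial profile in `z` -/
noncomputable def gz (p : ℕ) (r : ℝ) : ℝ → ℝ := (Set.Iio (1 / r)).indicator (fun y => y ^ (2 * p))

lemma gz_mul (p : ℕ) (r : ℝ) : (fun y : ℝ => y ^ (Module.finrank ℝ ℂ - 1) • gz p r y) =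
    (Set.Iio (1 / r)).indicator (fun y => y ^ (2 * p + 1)) := by
  funext y
  by_cases h : y ∈ Set.Iio (1 / r)
  · simp only [gz, Set.indicator_of_mem h, Complex.finrank_real_complex, smul_eq_mul]; ring
  · simp only [gz, Set.indicator_of_notMem h, smul_zero]

lemma gz_int (p : ℕ) (r : ℝ) : Integrable (fun z : ℂ => gz p r ‖z‖) := by
  rw [integrable_fun_norm_addHaar volume (f := gz p r), gz_mul]
  rw [integrableOn_indicator_iff measurableSet_Iio, Set.Iio_inter_Ioi]
  exact (continuous_pow _).integrableOn_Icc.mono_set Set.Ioo_subset_Icc_self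

lemma gz_integral (p : ℕ) : ∃ c : ℝ, 0 < c ∧ ∀ r : ℝ, 0 < r →
    ∫ z : ℂ, gz p r ‖z‖ = c * (1 / r) ^ (2 * p + 2) := by
  refine ⟨2 * (volume.real (Metric.ball (0:ℂ) 1)) / (2 * p + 2), ?_, ?_⟩
  · have : 0 < volume.real (Metric.ball (0:ℂ) 1) :=
      ENNReal.toReal_pos (Metric.measure_ball_pos _ _ one_pos).ne' measure_ball_lt_top.ne
    positivity
  · intro r hr
    rw [integral_fun_norm_addHaar volume (f := gz p r), gz_mul,
      setIntegral_indicator measurableSet_Iio, Set.Ioi_inter_Iio,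
      ← integral_Ioc_eq_integral_Ioo, ← intervalIntegral.integral_of_le (by positivity), integral_pow]
    simp [Complex.finrank_real_complex]
    ring

lemma step2 (p q : ℕ) (m : ℤ) :
    IntegrableOn (fun zw : ℂ × ℂ => ‖zw.1‖ ^ (2 * p) * ‖zw.2‖ ^ (2 * q) *
          (‖zw.2‖ ^ 2) ^ m) YY volume ↔ (q : ℤ) - p + m < 0 := by
  obtain ⟨c, hc, hi⟩ := gz_integral p
  set hw : ℝ → ℝ := (Set.Ioi (Real.sqrt 2)).indicator (fun y => y ^ (2 * q) * (y ^ 2) ^ m) with hhw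
  have hw0 : ∀ y, 0 ≤ hw y := fun y => Set.indicator_nonneg (fun y hy => by
    have : 0 < y := (Real.sqrt_nonneg 2).trans_lt hy
    positivity) y
  have gz0 : ∀ r (z : ℂ), 0 ≤ gz p r ‖z‖ := fun r z => by
    unfold gz
    by_cases h : ‖z‖ ∈ Set.Iio (1 / r)
    · rw [Set.indicator_of_mem h]; positivity
    · rw [Set.indicator_of_notMem h]
  rw [← integrable_indicator_iff YY_meas]
  have e1 : YY.indicator (fun zw : ℂ × ℂ => ‖zw.1‖ ^ (2 * p) * ‖zw.2‖ ^ (2 * q) *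
          (‖zw.2‖ ^ 2) ^ m) = fun zw => gz p ‖zw.2‖ ‖zw.1‖ * hw ‖zw.2‖ := by
    funext x
    by_cases h1 : Real.sqrt 2 < ‖x.2‖ <;> by_cases h2 : ‖x.1‖ < 1 / ‖x.2‖ <;>
      simp only [gz, hhw, Set.indicator, YY, Set.mem_ofPred_eq, Set.mem_Ioi, Set.mem_Iio, h1, h2] <;> simp [mul_assoc]
  have hmeas : AEStronglyMeasurable (YY.indicator (fun zw : ℂ × ℂ => ‖zw.1‖ ^ (2 * p) * ‖zw.2‖ ^ (2 * q) *
          (‖zw.2‖ ^ 2) ^ m)) (volume.prod volume) :=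
    (Measurable.indicator (by measurability) YY_meas).aestronglyMeasurable
  rw [Measure.volume_eq_prod, integrable_prod_iff' hmeas, e1]
  have e2 : (fun y : ℂ => ∫ x : ℂ, ‖gz p ‖y‖ ‖x‖ * hw ‖y‖‖) =
      fun y : ℂ => (fun r => c * (1 / r) ^ (2 * p + 2) * hw r) ‖y‖ := by
    funext y
    have : ∀ x : ℂ, ‖gz p ‖y‖ ‖x‖ * hw ‖y‖‖ = gz p ‖y‖ ‖x‖ * hw ‖y‖ := fun x =>
      Real.norm_of_nonneg (mul_nonneg (gz0 _ _) (hw0 _))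
    simp only [this]
    rw [integral_mul_const]
    by_cases h : 0 < ‖y‖
    · rw [hi _ h]
    · have : hw ‖y‖ = 0 := by
        apply Set.indicator_of_notMem
        simp only [Set.mem_Ioi, not_lt]
        exact (not_lt.1 h).trans (Real.sqrt_nonneg 2)
      simp [this]
  dsimp only
  rw [e2, integrable_fun_norm_addHaar volume (f := fun r => c * (1 / r) ^ (2 * p + 2) * hw r)]
  have e3 : (fun y : ℝ => y ^ (Module.finrank ℝ ℂ - 1) • (c * (1 / y) ^ (2 * p + 2) * hw y)) =
      (Set.Ioi (Real.sqrt 2)).indicator (fun y => c * y ^ ((2 * (q - p + m) - 1 : ℤ) : ℝ)) := by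
    funext y
    by_cases h : y ∈ Set.Ioi (Real.sqrt 2)
    · have hy : 0 < y := (Real.sqrt_nonneg 2).trans_lt h
      simp only [hhw, Set.indicator_of_mem h, Complex.finrank_real_complex, smul_eq_mul]
      rw [Real.rpow_intCast]
      have : (2 * (q - p + m) - 1 : ℤ) = 1 + -((2 * p + 2 : ℕ) : ℤ) + ((2 * q : ℕ) : ℤ) + 2 * m := by
        push_cast; ring
      rw [this, zpow_add₀ hy.ne', zpow_add₀ hy.ne', zpow_add₀ hy.ne', zpow_neg, zpow_natCast, zpow_natCast, zpow_mul]
      simp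
      ring
    · simp only [hhw, Set.indicator_of_notMem h, mul_zero, smul_zero]
  rw [e3, integrableOn_indicator_iff measurableSet_Ioi,
    Set.inter_eq_left.2 (Set.Ioi_subset_Ioi (Real.sqrt_nonneg 2)), IntegrableOn,
    integrable_const_mul_iff (IsUnit.mk0 c hc.ne'), ← IntegrableOn,
    integrableOn_Ioi_rpow_iff (by positivity)]
  have h1 : ∀ᵐ y : ℂ, Integrable (fun x : ℂ => gz p ‖y‖ ‖x‖ * hw ‖y‖) :=
    Filter.Eventually.of_forall fun y => (gz_int p ‖y‖).mul_const _
  rw [and_iff_right h1]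
  have : (-1 : ℝ) = ((-1 : ℤ) : ℝ) := by simp
  rw [this, Int.cast_lt]
  omega


/-- the monomial `z^p w^q` is square-integrable on
`Y = {|w| > √2, |z| < 1/|w|}` with weight `(1+|z|²+|w|²)^{-(k+3)}`
iff `q - p ≤ k + 2`. -/
theorem stmt_19 (k : ℤ) (p q : ℕ) :
    IntegrableOn
      (fun zw : ℂ × ℂ =>
        ‖zw.1‖ ^ (2 * p) * ‖zw.2‖ ^ (2 * q) *
          (1 + ‖zw.1‖ ^ 2 + ‖zw.2‖ ^ 2) ^ (-(k + 3)))
      {zw : ℂ × ℂ | Real.sqrt 2 < ‖zw.2‖ ∧ ‖zw.1‖ < 1 / ‖zw.2‖}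
      volume ↔
    (q : ℤ) - p ≤ k + 2 := by

  have h1 := step1 p q (-(k + 3))
  have h2 := step2 p q (-(k + 3))
  unfold YY at h1 h2
  rw [h1, h2]
  omega
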